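/- arXiv:1705.02815 — 3 statements merged into one kernel-verified Lean document; each statement's English description precedes it below -/
import Mathlib

section
/- (Theorem 1) Let N ≥ 1, let c ∈ ℝ^N, let β̄ ∈ ℝ^{2N−1} be componentwise nonnegative, and suppose the PE-zonotope Z = Z(G^{PE},c,β̄) is full-dimensional (its affine span is all of ℝ^N). Then every facet of Z admits a normal vector of the form ε·Σ_{i=j}^{k} e_i for some 1 ≤ j ≤ k ≤ N and some sign ε ∈ {+1,−1}; that is, every facet F of Z satisfies F = {z ∈ Z : ⟨ε·Σ_{i=j}^{k} e_i, z⟩ = max_{z'∈Z} ⟨ε·Σ_{i=j}^{k} e_i, z'⟩} for some such j, k, ε. -/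
open Matrix Finset

noncomputable section

/-- The zonotope `Z(G, c, β̄) = {c + Gβ : -β̄ ≤ β ≤ β̄}`. -/
def zonotope {N : ℕ} {ι : Type*} [Fintype ι] (G : Matrix (Fin N) ι ℝ) (c : Fin N → ℝ)
    (βb : ι → ℝ) : Set (Fin N → ℝ) :=
  {z | ∃ β : ι → ℝ, (∀ i, -βb i ≤ β i ∧ β i ≤ βb i) ∧ z = c + G.mulVec β}

/-- The PE generator matrix `G^{PE} ∈ ℝ^{N×(2N-1)}`: its first `N` columns (indexed by
`Sum.inl`) are the standard basis vectors `e_i`, and its last `N-1` columns (indexed by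
`Sum.inr j`, 0-indexed) are `(e_{j+1} - e_j)/√2`. -/
def GPE (N : ℕ) : Matrix (Fin N) (Fin N ⊕ Fin (N - 1)) ℝ :=
  Matrix.of fun n i =>
    match i with
    | Sum.inl m => if n = m then 1 else 0
    | Sum.inr j =>
        (if (n : ℕ) = (j : ℕ) + 1 then 1 else if (n : ℕ) = (j : ℕ) then -1 else 0) /
          Real.sqrt 2

/-- `F` is the exposed face of `Z` in the direction of the (nonzero) normal vector `v`,
i.e. the set of points of `Z` maximizing `z ↦ ⟨v, z⟩` over `Z`. -/
def IsExposedFaceWithNormal {N : ℕ} (Z F : Set (Fin N → ℝ)) (v : Fin N → ℝ) : Prop :=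
  v ≠ 0 ∧ F = {z ∈ Z | ∀ z' ∈ Z, v ⬝ᵥ z' ≤ v ⬝ᵥ z}

/-- `F` is a facet of `Z`: an exposed face whose affine span has dimension `N - 1`. -/
def IsFacet {N : ℕ} (Z F : Set (Fin N → ℝ)) : Prop :=
  (∃ v, IsExposedFaceWithNormal Z F v) ∧
    Module.finrank ℝ (affineSpan ℝ F).direction = N - 1

/-- A finitely supported nonzero sequence has a maximal block of consecutive indices on which it
is constant and nonzero. -/
theorem exists_maximal_constant_block {N : ℕ} {a : ℕ → ℝ} (ha : ∀ n, N ≤ n → a n = 0)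
    (hne : ∃ n, a n ≠ 0) :
    ∃ j k, j ≤ k ∧ k < N ∧ a j ≠ 0 ∧ (∀ i, j ≤ i → i ≤ k → a i = a j) ∧
      a (k + 1) ≠ a j ∧ ∀ i, i + 1 = j → a i ≠ a j := by
  classical
  have hex : ∃ k, Nat.find hne ≤ k ∧ a (k + 1) ≠ a (Nat.find hne) := by
    refine ⟨max (Nat.find hne) N, le_max_left _ _, ?_⟩
    rw [ha _ (by omega)]
    exact (Nat.find_spec hne).symm
  have hconst : ∀ i, Nat.find hne ≤ i → i ≤ Nat.find hex → a i = a (Nat.find hne) := by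
    intro i hi
    induction i, hi using Nat.le_induction with
    | base => intro _; rfl
    | succ i hi _ =>
      intro hik
      by_contra h
      exact Nat.find_min hex (m := i) (by omega) ⟨hi, h⟩
  obtain ⟨hjk, hk⟩ := Nat.find_spec hex
  refine ⟨Nat.find hne, Nat.find hex, hjk, ?_, Nat.find_spec hne, hconst, hk, ?_⟩
  · by_contra h
    exact Nat.find_spec hne ((hconst _ hjk le_rfl).symm.trans (ha _ (by omega)))
  · intro i hi h
    exact Nat.find_min hne (m := i) (by omega) (h ▸ Nat.find_spec hne)

theorem dotProduct_add_mulVec {N : ℕ} {ι : Type*} [Fintype ι] (G : Matrix (Fin N) ι ℝ)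
    (c v : Fin N → ℝ) (β : ι → ℝ) :
    v ⬝ᵥ (c + G.mulVec β) = v ⬝ᵥ c + ∑ i, (v ᵥ* G) i * β i := by
  rw [dotProduct_add, dotProduct_mulVec]
  rfl

/-- At a maximizer of `⟨v, ·⟩` over a zonotope, every coefficient whose generator is not
orthogonal to `v` attains its extreme value. -/
theorem vecMul_mul_eq_of_isMax {N : ℕ} {ι : Type*} [Fintype ι] {G : Matrix (Fin N) ι ℝ}
    {c v : Fin N → ℝ} {βb β : ι → ℝ} (hβb : ∀ i, 0 ≤ βb i)
    (hβ : ∀ i, -βb i ≤ β i ∧ β i ≤ βb i)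
    (hmax : ∀ z ∈ zonotope G c βb, v ⬝ᵥ z ≤ v ⬝ᵥ (c + G.mulVec β)) (i : ι) :
    (v ᵥ* G) i * β i = |(v ᵥ* G) i| * βb i := by
  have hle : ∀ i ∈ univ, (v ᵥ* G) i * β i ≤ |(v ᵥ* G) i| * βb i := fun i _ =>
    (le_abs_self _).trans (by
      rw [abs_mul]
      exact mul_le_mul_of_nonneg_left (abs_le.2 (hβ i)) (abs_nonneg _))
  have hz := hmax (c + G.mulVec fun i => SignType.sign ((v ᵥ* G) i) * βb i) ⟨_, fun i => by
    have := hβb i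
    rcases lt_trichotomy ((v ᵥ* G) i) 0 with h | h | h <;> simp [h] <;> linarith, rfl⟩
  simp only [dotProduct_add_mulVec, ← mul_assoc, self_mul_sign] at hz
  exact (Finset.sum_eq_sum_iff_of_le hle).1
    (le_antisymm (Finset.sum_le_sum hle) (by linarith)) i (mem_univ i)

/-- A vector orthogonal to every generator that is orthogonal to `v` is orthogonal to the
direction of the face of the zonotope with normal `v`. -/
theorem dotProduct_eq_zero_of_mem_direction {N : ℕ} {ι : Type*} [Fintype ι]
    {G : Matrix (Fin N) ι ℝ} {c v w : Fin N → ℝ} {βb : ι → ℝ} {F : Set (Fin N → ℝ)}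
    (hβb : ∀ i, 0 ≤ βb i) (hF : IsExposedFaceWithNormal (zonotope G c βb) F v)
    (hw : ∀ i, (v ᵥ* G) i = 0 → (w ᵥ* G) i = 0) {x : Fin N → ℝ}
    (hx : x ∈ (affineSpan ℝ F).direction) : w ⬝ᵥ x = 0 := by
  suffices (affineSpan ℝ F).direction ≤ LinearMap.ker (dotProductBilin ℝ ℝ w) from this hx
  rw [direction_affineSpan, vectorSpan, Submodule.span_le]
  rintro _ ⟨z, hz, z', hz', rfl⟩
  rw [hF.2] at hz hz'
  obtain ⟨⟨β, hβ, rfl⟩, hmax⟩ := hz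
  obtain ⟨⟨β', hβ', rfl⟩, hmax'⟩ := hz'
  change w ⬝ᵥ ((c + G.mulVec β) - (c + G.mulVec β')) = 0
  rw [dotProduct_sub, dotProduct_add_mulVec, dotProduct_add_mulVec, add_sub_add_left_eq_sub,
    ← Finset.sum_sub_distrib]
  refine Finset.sum_eq_zero fun i _ => ?_
  by_cases h : (v ᵥ* G) i = 0
  · simp [hw i h]
  · rw [mul_left_cancel₀ h ((vecMul_mul_eq_of_isMax hβb hβ hmax i).trans
      (vecMul_mul_eq_of_isMax hβb hβ' hmax' i).symm), sub_self]

/-- Vectors orthogonal to a common hyperplane are proportional. -/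
theorem exists_eq_smul_of_finrank_eq {N : ℕ} {D : Submodule ℝ (Fin N → ℝ)} {v w : Fin N → ℝ}
    (hD : Module.finrank ℝ D = N - 1) (hv0 : v ≠ 0) (hv : ∀ x ∈ D, v ⬝ᵥ x = 0)
    (hw : ∀ x ∈ D, w ⬝ᵥ x = 0) : ∃ l : ℝ, w = l • v := by
  have hvv : v ⬝ᵥ v ≠ 0 := by simpa [dotProduct_self_eq_zero] using hv0
  have hφ : (dotProductBilin ℝ ℝ v : Module.Dual ℝ (Fin N → ℝ)) ≠ 0 := fun h =>
    hvv (LinearMap.congr_fun h v)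
  have hker := Module.Dual.finrank_ker_add_one_of_ne_zero hφ
  rw [Module.finrank_fin_fun] at hker
  have hDker : D = LinearMap.ker (dotProductBilin ℝ ℝ v : Module.Dual ℝ (Fin N → ℝ)) :=
    Submodule.eq_of_le_of_finrank_eq (fun x hx => hv x hx) (by omega)
  have key : ∀ x, v ⬝ᵥ x = 0 → w ⬝ᵥ x = 0 := fun x hx => hw x (by rw [hDker]; exact hx)
  refine ⟨w ⬝ᵥ v / v ⬝ᵥ v, dotProduct_eq _ _ fun x => ?_⟩
  have := key (x - (v ⬝ᵥ x / v ⬝ᵥ v) • v) (by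
    simp only [dotProduct_sub, dotProduct_smul, smul_eq_mul]
    field_simp
    ring)
  simp only [dotProduct_sub, dotProduct_smul, smul_dotProduct, smul_eq_mul] at this ⊢
  field_simp at this ⊢
  linarith

theorem IsExposedFaceWithNormal.smul {N : ℕ} {Z F : Set (Fin N → ℝ)} {v : Fin N → ℝ} {l : ℝ}
    (hF : IsExposedFaceWithNormal Z F v) (hl : 0 < l) :
    IsExposedFaceWithNormal Z F (l • v) := by
  refine ⟨smul_ne_zero hl.ne' hF.1, ?_⟩
  simp only [smul_dotProduct, smul_eq_mul, mul_le_mul_iff_right₀ hl]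
  exact hF.2

theorem vecMul_GPE_inl {N : ℕ} (v : Fin N → ℝ) (m : Fin N) :
    (v ᵥ* GPE N) (Sum.inl m) = v m := by
  simp [vecMul, dotProduct, GPE]

theorem vecMul_GPE_inr {N : ℕ} (v : Fin N → ℝ) (j : Fin (N - 1)) :
    (v ᵥ* GPE N) (Sum.inr j) =
      (v ⟨j + 1, by omega⟩ - v ⟨j, by omega⟩) / Real.sqrt 2 := by
  have h (n : Fin N) : (if (n : ℕ) = (j : ℕ) + 1 then (1 : ℝ) else if (n : ℕ) = (j : ℕ) then -1
      else 0) = (if n = ⟨j + 1, by omega⟩ then 1 else 0) - if n = ⟨j, by omega⟩ then 1 else 0 := by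
    simp only [Fin.ext_iff]
    split_ifs <;> first | omega | norm_num
  simp [vecMul, dotProduct, GPE, h, ← mul_div_assoc, ← Finset.sum_div, mul_sub]

/-- (Theorem 1) Every facet of a full-dimensional PE-zonotope admits a normal vector of the
form `ε · ∑_{i=j}^{k} e_i` for some block of consecutive coordinates `j ≤ k` (0-indexed,
`k < N`) and a sign `ε ∈ {+1, -1}`. -/
theorem facets_of_PE_zonotope {N : ℕ} (hN : 1 ≤ N) (c : Fin N → ℝ)
    (βb : Fin N ⊕ Fin (N - 1) → ℝ) (hβb : ∀ i, 0 ≤ βb i)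
    (hfull : affineSpan ℝ (zonotope (GPE N) c βb) = ⊤)
    (F : Set (Fin N → ℝ)) (hF : IsFacet (zonotope (GPE N) c βb) F) :
    ∃ (j k : ℕ) (ε : ℝ), j ≤ k ∧ k < N ∧ (ε = 1 ∨ ε = -1) ∧
      IsExposedFaceWithNormal (zonotope (GPE N) c βb) F
        (fun i => if j ≤ (i : ℕ) ∧ (i : ℕ) ≤ k then ε else 0) := by
  obtain ⟨⟨v, hv⟩, hdim⟩ := hF
  obtain ⟨a, ha⟩ : ∃ a : ℕ → ℝ, a = fun n => if h : n < N then v ⟨n, h⟩ else 0 := ⟨_, rfl⟩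
  have hav (i : Fin N) : v i = a i := by simp [ha]
  obtain ⟨n, hn⟩ := Function.ne_iff.1 hv.1
  obtain ⟨j, k, hjk, hkN, hj0, hconst, hright, hleft⟩ :=
    exists_maximal_constant_block (N := N) (a := a) (fun n hn => by simp [ha, hn])
      ⟨n, by simpa [← hav] using hn⟩
  obtain ⟨ε, hε, hεa⟩ : ∃ ε : ℝ, (ε = 1 ∨ ε = -1) ∧ 0 < ε * a j := by
    rcases lt_or_gt_of_ne hj0 with h | h
    · exact ⟨-1, .inr rfl, by linarith⟩
    · exact ⟨1, .inl rfl, by linarith⟩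
  refine ⟨j, k, ε, hjk, hkN, hε, ?_⟩
  set w : Fin N → ℝ := fun i => if j ≤ (i : ℕ) ∧ (i : ℕ) ≤ k then ε else 0 with hwdef
  have hw : ∀ i, (v ᵥ* GPE N) i = 0 → (w ᵥ* GPE N) i = 0 := by
    rintro (m | m) h
    · rw [vecMul_GPE_inl, hav] at h
      rw [vecMul_GPE_inl]
      exact if_neg fun hm : j ≤ (m : ℕ) ∧ (m : ℕ) ≤ k => hj0 (hconst m hm.1 hm.2 ▸ h)
    · rw [vecMul_GPE_inr, div_eq_zero_iff, or_iff_left (by positivity), hav, hav,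
        sub_eq_zero] at h
      rw [vecMul_GPE_inr, div_eq_zero_iff, or_iff_left (by positivity), sub_eq_zero]
      simp only at h
      have hiff : (j ≤ (m : ℕ) + 1 ∧ (m : ℕ) + 1 ≤ k) ↔ (j ≤ (m : ℕ) ∧ (m : ℕ) ≤ k) := by
        constructor
        · rintro ⟨h1, h2⟩
          refine ⟨?_, by omega⟩
          by_contra hlt
          exact hleft m (by omega) (h.symm.trans (hconst _ h1 h2))
        · rintro ⟨h1, h2⟩
          refine ⟨by omega, ?_⟩
          by_contra hlt
          obtain rfl : (m : ℕ) = k := by omega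
          exact hright (h.trans (hconst _ h1 h2))
      simp only [hwdef, hiff]
  obtain ⟨l, hl⟩ := exists_eq_smul_of_finrank_eq hdim hv.1
    (fun x => dotProduct_eq_zero_of_mem_direction hβb hv fun _ h => h)
    (fun x => dotProduct_eq_zero_of_mem_direction hβb hv hw)
  rw [hl]
  refine hv.smul ?_
  have hlj : ε = l * a j := by
    simpa [hwdef, hjk, hav] using congrFun hl ⟨j, by omega⟩
  rw [hlj, mul_assoc] at hεa
  exact pos_of_mul_pos_left hεa (mul_self_nonneg _)
end
end

section
/- (Theorem 2) Let N ≥ 1, let c ∈ ℝ^N, and let β̄ ∈ ℝ^{2N−1} satisfy β̄_i > 0 for all i. Then for every pair of indices 1 ≤ j ≤ k ≤ N, the vector u := Σ_{i=j}^{k} e_i defines a facet of the PE-zonotope Z = Z(G^{PE},c,β̄); that is, the set F := {z ∈ Z : ⟨u,z⟩ = max_{z'∈Z} ⟨u,z'⟩} has affine dimension exactly N−1. -/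
open Matrix Finset

noncomputable section

/-- A coefficient vector saturating every generator that is not orthogonal to `v` gives a
point of the exposed face of the zonotope with normal vector `v`. -/
lemma mem_exposedFace_of_saturated {N : ℕ} {ι : Type*} [Fintype ι] (G : Matrix (Fin N) ι ℝ)
    (c : Fin N → ℝ) (βb : ι → ℝ) (v : Fin N → ℝ) (β : ι → ℝ)
    (hβ : ∀ i, -βb i ≤ β i ∧ β i ≤ βb i) (hsat : ∀ i, (v ᵥ* G) i * β i = |(v ᵥ* G) i| * βb i) :
    c + G *ᵥ β ∈ {z ∈ zonotope G c βb | ∀ z' ∈ zonotope G c βb, v ⬝ᵥ z' ≤ v ⬝ᵥ z} := by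
  refine ⟨⟨β, hβ, rfl⟩, ?_⟩
  rintro _ ⟨γ, hγ, rfl⟩
  rw [dotProduct_add, dotProduct_add, dotProduct_mulVec, dotProduct_mulVec]
  refine add_le_add_right (Finset.sum_le_sum fun i _ => ?_) _
  rw [hsat i]
  calc (v ᵥ* G) i * γ i ≤ |(v ᵥ* G) i * γ i| := le_abs_self _
    _ = |(v ᵥ* G) i| * |γ i| := abs_mul _ _
    _ ≤ |(v ᵥ* G) i| * βb i :=
      mul_le_mul_of_nonneg_left (abs_le.mpr (hγ i)) (abs_nonneg _)

/-- Generators orthogonal to `v` are directions of the exposed face with normal vector `v`. -/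
lemma col_mem_vectorSpan_exposedFace {N : ℕ} {ι : Type*} [Fintype ι] (G : Matrix (Fin N) ι ℝ)
    (c : Fin N → ℝ) (βb : ι → ℝ) (hβb : ∀ i, 0 < βb i) (v : Fin N → ℝ) (i : ι)
    (hi : (v ᵥ* G) i = 0) :
    G.col i ∈ vectorSpan ℝ
      {z ∈ zonotope G c βb | ∀ z' ∈ zonotope G c βb, v ⬝ᵥ z' ≤ v ⬝ᵥ z} := by
  classical
  let β : ι → ℝ := fun l => SignType.sign ((v ᵥ* G) l) * βb l
  have hβi : β i = 0 := by simp [β, hi]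
  have hβ : ∀ l, -βb l ≤ β l ∧ β l ≤ βb l := fun l => by
    have := hβb l
    rcases lt_trichotomy ((v ᵥ* G) l) 0 with h | h | h <;> simp [β, h] <;> linarith
  have hsat : ∀ l, (v ᵥ* G) l * β l = |(v ᵥ* G) l| * βb l := fun l => by
    simp only [β, ← mul_assoc, self_mul_sign]
  have h₀ := mem_exposedFace_of_saturated G c βb v β hβ hsat
  have h₁ := mem_exposedFace_of_saturated G c βb v (β + Pi.single i (βb i))
    (fun l => by
      by_cases hl : l = i
      · subst hl
        simpa [hβi] using (hβb l).le
      · simpa [hl] using hβ l)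
    (fun l => by
      by_cases hl : l = i
      · subst hl
        simp [hi]
      · simpa [hl] using hsat l)
  have h := vsub_mem_vectorSpan ℝ h₁ h₀
  rw [vsub_eq_sub, mulVec_add, ← add_assoc, add_sub_cancel_left, mulVec_single,
    op_smul_eq_smul] at h
  exact (Submodule.smul_mem_iff _ (hβb i).ne').mp h

/-- The value of a functional is constant on its exposed face. -/
lemma vectorSpan_exposedFace_le_ker {N : ℕ} (Z : Set (Fin N → ℝ)) (v : Fin N → ℝ) :
    vectorSpan ℝ {z ∈ Z | ∀ z' ∈ Z, v ⬝ᵥ z' ≤ v ⬝ᵥ z} ≤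
      LinearMap.ker (dotProductEquiv ℝ (Fin N) v) := by
  refine Submodule.span_le.mpr ?_
  rintro _ ⟨x, hx, y, hy, rfl⟩
  simp [dotProduct_sub, le_antisymm (hy.2 x hx.1) (hx.2 y hy.1)]

lemma GPE_col_inl {N : ℕ} (i : Fin N) : (GPE N).col (Sum.inl i) = Pi.single i 1 := by
  ext n
  simp [GPE, Pi.single_apply]

lemma GPE_col_inr {N i : ℕ} (hi : i + 1 < N) :
    (GPE N).col (Sum.inr ⟨i, by omega⟩) =
      (Real.sqrt 2)⁻¹ • (Pi.single ⟨i + 1, hi⟩ 1 - Pi.single ⟨i, by omega⟩ 1) := by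
  ext n
  simp only [GPE, Matrix.col_apply, Matrix.of_apply, Pi.smul_apply, Pi.sub_apply, Pi.single_apply,
    Fin.ext_iff, smul_eq_mul]
  split_ifs <;> first | omega | ring

/-- A submodule containing `e_i` for `i` outside the block `[j, k]` and `e_{i+1} - e_i` within the
block contains every vector whose coordinates over the block sum to zero. -/
lemma ker_block_le {N : ℕ} {j k : ℕ} (hjk : j ≤ k) (hkN : k < N) (W : Submodule ℝ (Fin N → ℝ))
    (hout : ∀ i : Fin N, ¬(j ≤ (i : ℕ) ∧ (i : ℕ) ≤ k) → Pi.single i 1 ∈ W)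
    (hin : ∀ (i : ℕ) (_ : j ≤ i) (hi : i + 1 ≤ k),
      (Pi.single ⟨i + 1, by omega⟩ 1 - Pi.single ⟨i, by omega⟩ 1 : Fin N → ℝ) ∈ W) :
    LinearMap.ker (dotProductEquiv ℝ (Fin N)
      (fun i : Fin N => if j ≤ (i : ℕ) ∧ (i : ℕ) ≤ k then (1 : ℝ) else 0)) ≤ W := by
  set u : Fin N → ℝ := fun i => if j ≤ (i : ℕ) ∧ (i : ℕ) ≤ k then (1 : ℝ) else 0 with hu
  let e : Fin N → ℝ := Pi.single ⟨j, by omega⟩ 1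
  have hblock : ∀ (i : ℕ) (_ : j ≤ i) (hi : i ≤ k),
      (Pi.single ⟨i, by omega⟩ 1 - e : Fin N → ℝ) ∈ W := by
    intro i hji
    induction i, hji using Nat.le_induction with
    | base => intro _; simp [e]
    | succ i hji ih =>
      intro hi
      simpa using W.add_mem (hin i hji hi) (ih (by omega))
  have hmem : ∀ i : Fin N, (Pi.single i 1 - u i • e : Fin N → ℝ) ∈ W := by
    intro i
    by_cases h : j ≤ (i : ℕ) ∧ (i : ℕ) ≤ k
    · simpa [hu, h] using hblock i h.1 h.2
    · simpa [hu, h] using hout i h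
  intro x hx
  have hux : ∑ i, x i * u i = 0 := by
    simpa [dotProduct, mul_comm] using hx
  have hsum : x = ∑ i, x i • (Pi.single i 1 - u i • e : Fin N → ℝ) := by
    simp only [smul_sub, Finset.sum_sub_distrib, smul_smul, ← Finset.sum_smul, hux, zero_smul,
      sub_zero]
    exact pi_eq_sum_univ' x
  rw [hsum]
  exact W.sum_mem fun i _ => W.smul_mem _ (hmem i)

/-- (Theorem 2) If all entries of `β̄` are positive, then for every block of consecutive
coordinates `j ≤ k` (0-indexed, `k < N`) the vector `u = ∑_{i=j}^{k} e_i` defines a facet of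
the PE-zonotope `Z(G^{PE}, c, β̄)`: the corresponding exposed face has affine dimension
exactly `N - 1`. -/
theorem block_vector_defines_facet {N : ℕ} (hN : 1 ≤ N) (c : Fin N → ℝ)
    (βb : Fin N ⊕ Fin (N - 1) → ℝ) (hβb : ∀ i, 0 < βb i)
    (j k : ℕ) (hjk : j ≤ k) (hkN : k < N) :
    Module.finrank ℝ
      (affineSpan ℝ
        {z ∈ zonotope (GPE N) c βb |
          ∀ z' ∈ zonotope (GPE N) c βb,
            (fun i : Fin N => if j ≤ (i : ℕ) ∧ (i : ℕ) ≤ k then (1 : ℝ) else 0) ⬝ᵥ z' ≤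
              (fun i : Fin N => if j ≤ (i : ℕ) ∧ (i : ℕ) ≤ k then (1 : ℝ) else 0) ⬝ᵥ z}).direction =
      N - 1 := by
  set u : Fin N → ℝ := fun i => if j ≤ (i : ℕ) ∧ (i : ℕ) ≤ k then (1 : ℝ) else 0 with hu
  set F := {z ∈ zonotope (GPE N) c βb | ∀ z' ∈ zonotope (GPE N) c βb, u ⬝ᵥ z' ≤ u ⬝ᵥ z}
  have hcol : ∀ i, u ⬝ᵥ (GPE N).col i = 0 → (GPE N).col i ∈ vectorSpan ℝ F := fun i hi =>
    col_mem_vectorSpan_exposedFace (GPE N) c βb hβb u i hi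
  have hker : LinearMap.ker (dotProductEquiv ℝ (Fin N) u) ≤ vectorSpan ℝ F := by
    refine ker_block_le hjk hkN _ (fun i hi => ?_) (fun i hji hik => ?_)
    · rw [← GPE_col_inl]
      refine hcol _ ?_
      simp [GPE_col_inl, hu, hi]
    · have hi : i + 1 < N := by omega
      have h := hcol (Sum.inr ⟨i, by omega⟩) (by
        rw [GPE_col_inr hi, dotProduct_smul, dotProduct_sub]
        simp [hu, hji, hik, show j ≤ i + 1 by omega, show i ≤ k by omega])
      rw [GPE_col_inr hi] at h
      exact (Submodule.smul_mem_iff _ (by positivity)).mp h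
  rw [direction_affineSpan, le_antisymm (vectorSpan_exposedFace_le_ker _ u) hker]
  have hne : dotProductEquiv ℝ (Fin N) u ≠ 0 := by
    rw [ne_eq, LinearEquiv.map_eq_zero_iff]
    intro h
    simpa [hu, hjk] using congrFun h ⟨j, by omega⟩
  have h := Module.Dual.finrank_ker_add_one_of_ne_zero hne
  rw [Module.finrank_fin_fun] at h
  omega
end
end

section
/- H-representation of a PE-zonotope: let N ≥ 1, c ∈ ℝ^N, and β̄ ∈ ℝ^{2N−1} with β̄_i > 0 for all i. Then a point p ∈ ℝ^N belongs to Z(G^{PE},c,β̄) if and only if for every pair of indices 1 ≤ j ≤ k ≤ N: |Σ_{i=j}^{k} (p_i − c_i)| ≤ Σ_{i=j}^{k} β̄_i + (1/√2)·β̄_{N+j−1}·[j > 1] + (1/√2)·β̄_{N+k}·[k < N], where [·] equals 1 if the condition holds and 0 otherwise. -/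
open Matrix Finset

noncomputable section

/-- The scaled coefficient of the edge generator between nodes `m - 1` and `m`, extended by zero
to all natural `m`. -/
def edgeCoeff {N : ℕ} (β : Fin N ⊕ Fin (N - 1) → ℝ) (m : ℕ) : ℝ :=
  if h : 0 < m ∧ m < N then β (Sum.inr ⟨m - 1, by omega⟩) / Real.sqrt 2 else 0

/-- Extension of a vector by zero to all natural indices. -/
def zeroExtend {N : ℕ} (v : Fin N → ℝ) (n : ℕ) : ℝ :=
  if h : n < N then v ⟨n, h⟩ else 0

lemma sum_edge_indicator {N : ℕ} (β : Fin N ⊕ Fin (N - 1) → ℝ) (m : ℕ) :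
    ∑ j : Fin (N - 1), (if m = (j : ℕ) + 1 then β (Sum.inr j) / Real.sqrt 2 else 0) =
      edgeCoeff β m := by
  unfold edgeCoeff
  split_ifs with h
  · rw [Finset.sum_eq_single (⟨m - 1, by omega⟩ : Fin (N - 1))]
    · rw [if_pos (by simp only; omega)]
    · intro j _ hj
      refine if_neg fun hm => hj (Fin.ext ?_)
      simp only
      omega
    · intro hm
      exact absurd (Finset.mem_univ _) hm
  · refine Finset.sum_eq_zero fun j _ => if_neg fun hm => h ?_
    have := j.isLt
    omega

lemma GPE_mulVec_apply {N : ℕ} (β : Fin N ⊕ Fin (N - 1) → ℝ) (n : Fin N) :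
    (GPE N).mulVec β n = β (Sum.inl n) + edgeCoeff β n - edgeCoeff β (n + 1) := by
  rw [← sum_edge_indicator β n, ← sum_edge_indicator β (n + 1), add_sub_assoc,
    ← Finset.sum_sub_distrib]
  simp only [Matrix.mulVec, dotProduct, GPE, Matrix.of_apply, Fintype.sum_sum_type]
  congr 1
  · simp
  · refine Finset.sum_congr rfl fun j _ => ?_
    by_cases h1 : (n : ℕ) = (j : ℕ) + 1
    · have h2 : ¬ (n : ℕ) + 1 = (j : ℕ) + 1 := by omega
      simp only [if_pos h1, if_neg h2]
      ring
    · by_cases h2 : (n : ℕ) = (j : ℕ)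
      · have h3 : (n : ℕ) + 1 = (j : ℕ) + 1 := by omega
        simp only [if_neg h1, if_pos h2, if_pos h3]
        ring
      · have h3 : ¬ (n : ℕ) + 1 = (j : ℕ) + 1 := by omega
        simp only [if_neg h1, if_neg h2, if_neg h3]
        ring

lemma sum_filter_block {N : ℕ} (v : Fin N → ℝ) {j k : ℕ} (hjk : j ≤ k) (hkN : k < N) :
    ∑ i ∈ Finset.univ.filter (fun i : Fin N => j ≤ (i : ℕ) ∧ (i : ℕ) ≤ k), v i =
      ∑ i ∈ Finset.range (k + 1), zeroExtend v i - ∑ i ∈ Finset.range j, zeroExtend v i := by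
  rw [← Finset.sum_Ico_eq_sub _ (by omega : j ≤ k + 1)]
  refine Finset.sum_bij (fun i _ => (i : ℕ)) ?_ ?_ ?_ ?_
  · intro i hi
    simp only [Finset.mem_filter, Finset.mem_univ, true_and] at hi
    rw [Finset.mem_Ico]
    omega
  · intro a _ b _ hab
    exact Fin.ext hab
  · intro b hb
    rw [Finset.mem_Ico] at hb
    refine ⟨⟨b, by omega⟩, ?_, rfl⟩
    simp only [Finset.mem_filter, Finset.mem_univ, true_and]
    omega
  · intro i _
    simp [zeroExtend]

/-- A sequence that is nonexpansive for the distance `|T m - T l|` and stays within `γ` of `S`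
exists on `{0, …, N}` iff the bands around `S` are pairwise compatible. -/
lemma exists_lipschitz_selection_iff {N : ℕ} {S T γ : ℕ → ℝ} (hT : Monotone T)
    (hγ : ∀ m, 0 ≤ γ m) :
    (∃ f : ℕ → ℝ, (∀ m ≤ N, |f m - S m| ≤ γ m) ∧
        ∀ m < N, |f (m + 1) - f m| ≤ T (m + 1) - T m) ↔
      ∀ j k, j < k → k ≤ N → |S k - S j| ≤ T k - T j + γ j + γ k := by
  constructor
  · rintro ⟨f, hf, hstep⟩ j k hjk hk
    have hlip : |f k - f j| ≤ T k - T j := by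
      induction k, hjk.le using Nat.le_induction with
      | base => simp
      | succ n hn ih =>
        rcases hn.eq_or_lt with rfl | hlt
        · exact hstep _ (by omega)
        · have h1 := abs_le.1 (ih hlt (by omega))
          have h2 := abs_le.1 (hstep n (by omega))
          exact abs_le.2 ⟨by linarith, by linarith⟩
    have h1 := abs_le.1 hlip
    have h2 := abs_le.1 (hf j (by omega))
    have h3 := abs_le.1 (hf k hk)
    exact abs_le.2 ⟨by linarith, by linarith⟩
  · intro h
    have hne : (Finset.range (N + 1)).Nonempty := ⟨0, by simp⟩
    have hpair : ∀ m ≤ N, ∀ l ≤ N, S m - γ m ≤ S l + γ l + |T m - T l| := by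
      intro m hm l hl
      rcases lt_trichotomy m l with hml | rfl | hml
      · have h1 := abs_le.1 (h m l hml hl)
        have h2 := neg_le_abs (T m - T l)
        linarith
      · have h1 := hγ m
        have h2 := abs_nonneg (T m - T m)
        linarith
      · have h1 := abs_le.1 (h l m hml hm)
        have h2 := le_abs_self (T m - T l)
        linarith
    set f : ℕ → ℝ := fun m =>
      (Finset.range (N + 1)).inf' hne fun l => S l + γ l + |T m - T l|
    have hlip : ∀ m n, f m ≤ f n + |T m - T n| := by
      intro m n
      rw [← sub_le_iff_le_add]
      refine Finset.le_inf' _ _ fun l hl => ?_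
      have h1 : f m ≤ S l + γ l + |T m - T l| := Finset.inf'_le _ hl
      have h2 := abs_sub_le (T m) (T n) (T l)
      linarith
    refine ⟨f, fun m hm => ?_, fun m _ => ?_⟩
    · have h1 : f m ≤ S m + γ m + |T m - T m| :=
        Finset.inf'_le _ (Finset.mem_range.2 (by omega))
      have h2 : S m - γ m ≤ f m :=
        Finset.le_inf' _ _ fun l hl => hpair m hm l (by rw [Finset.mem_range] at hl; omega)
      rw [sub_self, abs_zero] at h1
      exact abs_le.2 ⟨by linarith, by linarith⟩
    · have h1 := hlip (m + 1) m
      have h2 := hlip m (m + 1)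
      rw [abs_sub_comm (T m)] at h2
      rw [abs_of_nonneg (sub_nonneg.2 (hT m.le_succ))] at h1 h2
      exact abs_le.2 ⟨by linarith, by linarith⟩

lemma mem_zonotope_GPE_iff {N : ℕ} (c p : Fin N → ℝ) (βb : Fin N ⊕ Fin (N - 1) → ℝ) :
    p ∈ zonotope (GPE N) c βb ↔
      ∃ f : ℕ → ℝ,
        (∀ m ≤ N, |f m - ∑ i ∈ Finset.range m, zeroExtend (p - c) i| ≤ edgeCoeff βb m) ∧
        ∀ m < N, |f (m + 1) - f m| ≤
          ∑ i ∈ Finset.range (m + 1), zeroExtend (fun i => βb (Sum.inl i)) i -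
            ∑ i ∈ Finset.range m, zeroExtend (fun i => βb (Sum.inl i)) i := by
  have hs : (0 : ℝ) < Real.sqrt 2 := Real.sqrt_pos.2 two_pos
  constructor
  · rintro ⟨β, hβ, rfl⟩
    refine ⟨fun m => ∑ i ∈ Finset.range m, zeroExtend (c + (GPE N).mulVec β - c) i +
      edgeCoeff β m, fun m _ => ?_, fun m hm => ?_⟩
    · rw [add_sub_cancel_left]
      unfold edgeCoeff
      split_ifs with h
      · rw [abs_div, abs_of_pos hs]
        gcongr
        exact abs_le.2 (hβ _)
      · simp
    · have h1 := GPE_mulVec_apply β ⟨m, hm⟩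
      simp only at h1
      simp only [Finset.sum_range_succ, add_sub_cancel_left]
      have h2 : zeroExtend ((GPE N).mulVec β) m = (GPE N).mulVec β ⟨m, hm⟩ := dif_pos hm
      have h3 : zeroExtend (fun i => βb (Sum.inl i)) m = βb (Sum.inl ⟨m, hm⟩) := dif_pos hm
      have h4 := hβ (Sum.inl ⟨m, hm⟩)
      rw [h2, h3, h1]
      exact abs_le.2 ⟨by linarith, by linarith⟩
  · rintro ⟨f, hf, hstep⟩
    set S : ℕ → ℝ := fun m => ∑ i ∈ Finset.range m, zeroExtend (p - c) i with hS
    set β : Fin N ⊕ Fin (N - 1) → ℝ := Sum.elim (fun i => f (i + 1) - f i)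
      (fun j => Real.sqrt 2 * (f (j + 1) - S (j + 1))) with hβ
    have hedge : ∀ m ≤ N, edgeCoeff β m = f m - S m := by
      intro m hm
      by_cases h : 0 < m ∧ m < N
      · have hm1 : m - 1 + 1 = m := by omega
        simp only [edgeCoeff, dif_pos h, hβ, Sum.elim_inr, hm1]
        field_simp
      · have h1 := hf m hm
        simp only [edgeCoeff, dif_neg h] at h1 ⊢
        exact (abs_nonpos_iff.1 h1).symm
    refine ⟨β, ?_, ?_⟩
    · rintro (i | j)
      · have h1 := hstep i i.isLt
        rw [Finset.sum_range_succ, add_sub_cancel_left] at h1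
        have h3 : zeroExtend (fun i => βb (Sum.inl i)) i = βb (Sum.inl i) := dif_pos i.isLt
        rw [h3] at h1
        exact abs_le.1 h1
      · have hj := j.isLt
        have h1 := hf (j + 1) (by omega)
        have h2 : edgeCoeff βb (j + 1) = βb (Sum.inr j) / Real.sqrt 2 :=
          dif_pos ⟨by omega, by omega⟩
        rw [h2, le_div_iff₀ hs] at h1
        refine abs_le.1 ?_
        rw [hβ, Sum.elim_inr, abs_mul, abs_of_pos hs, mul_comm]
        exact h1
    · funext n
      have hn := n.isLt
      have h1 : S (n + 1) = S n + (p n - c n) := by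
        rw [hS]
        simp [Finset.sum_range_succ, zeroExtend]
      rw [Pi.add_apply, GPE_mulVec_apply, hedge n hn.le, hedge (n + 1) hn, h1]
      simp only [hβ, Sum.elim_inl]
      ring

/-- H-representation of a PE-zonotope with strictly positive `β̄`: a point `p` lies in
`Z(G^{PE}, c, β̄)` iff for every block of consecutive coordinates `j ≤ k` (0-indexed,
`k < N`), `|∑_{i=j}^{k} (p_i - c_i)|` is at most `∑_{i=j}^{k} β̄_i` plus `(1/√2)` times the
bound of the edge generator just below the block (when `j > 0`) plus `(1/√2)` times the
bound of the edge generator just above the block (when `k < N - 1`). -/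
theorem PE_zonotope_H_representation {N : ℕ} (hN : 1 ≤ N) (c : Fin N → ℝ)
    (βb : Fin N ⊕ Fin (N - 1) → ℝ) (hβb : ∀ i, 0 < βb i) (p : Fin N → ℝ) :
    p ∈ zonotope (GPE N) c βb ↔
      ∀ (j k : ℕ), ∀ hjk : j ≤ k, ∀ hkN : k < N,
        |∑ i ∈ Finset.univ.filter (fun i : Fin N => j ≤ (i : ℕ) ∧ (i : ℕ) ≤ k), (p i - c i)| ≤
          (∑ i ∈ Finset.univ.filter (fun i : Fin N => j ≤ (i : ℕ) ∧ (i : ℕ) ≤ k),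
              βb (Sum.inl i)) +
            (if hj : 0 < j then βb (Sum.inr ⟨j - 1, by omega⟩) / Real.sqrt 2 else 0) +
            (if hk : k < N - 1 then βb (Sum.inr ⟨k, by omega⟩) / Real.sqrt 2 else 0) := by
  have hγ : ∀ m, 0 ≤ edgeCoeff βb m := by
    intro m
    unfold edgeCoeff
    split_ifs
    · exact div_nonneg (hβb _).le (Real.sqrt_nonneg 2)
    · exact le_rfl
  have hT : Monotone fun m =>
      ∑ i ∈ Finset.range m, zeroExtend (fun i => βb (Sum.inl i)) i := by
    refine monotone_nat_of_le_succ fun m => ?_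
    rw [Finset.sum_range_succ, le_add_iff_nonneg_right]
    unfold zeroExtend
    split_ifs
    · exact (hβb _).le
    · exact le_rfl
  rw [mem_zonotope_GPE_iff, exists_lipschitz_selection_iff hT hγ]
  have key : ∀ (j k : ℕ) (hjk : j ≤ k) (hkN : k < N),
      (if hj : 0 < j then βb (Sum.inr ⟨j - 1, by omega⟩) / Real.sqrt 2 else 0) =
        edgeCoeff βb j ∧
      (if hk : k < N - 1 then βb (Sum.inr ⟨k, by omega⟩) / Real.sqrt 2 else 0) =
        edgeCoeff βb (k + 1) := by
    intro j k hjk hkN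
    unfold edgeCoeff
    constructor
    · by_cases h : 0 < j
      · rw [dif_pos h, dif_pos ⟨h, by omega⟩]
      · rw [dif_neg h, dif_neg fun h' => h h'.1]
    · by_cases h : k < N - 1
      · rw [dif_pos h, dif_pos ⟨by omega, by omega⟩]
        rfl
      · rw [dif_neg h, dif_neg (by omega)]
  constructor
  · intro h j k hjk hkN
    rw [(key j k hjk hkN).1, (key j k hjk hkN).2, sum_filter_block _ hjk hkN,
      sum_filter_block _ hjk hkN]
    exact h j (k + 1) (by omega) hkN
  · intro h j k hjk hkN
    obtain ⟨k, rfl⟩ : ∃ l, k = l + 1 := ⟨k - 1, by omega⟩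
    have hjk' : j ≤ k := by omega
    have := h j k hjk' hkN
    rw [(key j k hjk' hkN).1, (key j k hjk' hkN).2, sum_filter_block _ hjk' hkN,
      sum_filter_block _ hjk' hkN] at this
    exact this
end
end
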